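/- For n ≥ 3, k ≥ 1 integer, and 0 < R < R + L, the Steklov-Dirichlet eigenvalues are strictly increasing in k: σ_(k)ᴰ < σ_(k+1)ᴰ, where σ_(k)ᴰ = (k + (k+n-2)(R+L)^(2k+n-2) R^(-2k+2-n))/((R+L)^(2k+n-2) R^(-2k+3-n) - R). -/

import Mathlib

open Real

noncomputable def sigmaDk (n : ℕ) (R L : ℝ) (k : ℕ) : ℝ :=
  ((k : ℝ) + ((k : ℝ) + n - 2) * (R + L) ^ (2 * (k : ℝ) + n - 2) * R ^ (-2 * (k : ℝ) + 2 - n)) /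
    ((R + L) ^ (2 * (k : ℝ) + n - 2) * R ^ (-2 * (k : ℝ) + 3 - n) - R)

lemma sd_key (q : ℝ) (hq : 1 < q) (m : ℕ) :
    0 < (q ^ (m+1) * q ^ 2 + 1) * (q ^ (m+1) - 1) - ((m:ℝ)+1) * q ^ (m+1) * (q ^ 2 - 1) := by
  induction m with
  | zero =>
    have : (q ^ (0+1) * q ^ 2 + 1) * (q ^ (0+1) - 1) - (((0:ℕ):ℝ)+1) * q ^ (0+1) * (q ^ 2 - 1)
        = (q - 1) * ((q - 1) * (q ^ 2 - 1)) := by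
      push_cast; ring
    rw [this]
    have : 0 < q - 1 := by linarith
    have : 0 < q ^ 2 - 1 := by nlinarith
    positivity
  | succ m ih =>
    have h1 : 0 < q - 1 := by linarith
    have h2 : 0 < q ^ (m+3) - 1 := sub_pos.2 (one_lt_pow₀ hq (by omega))
    have h3 : 0 < q ^ (m+2) - 1 := sub_pos.2 (one_lt_pow₀ hq (by omega))
    have h4 : 0 < q := by linarith
    have h5 := mul_pos h4 ih
    have h6 : 0 < (q - 1) * ((q ^ (m+3) - 1) * (q ^ (m+2) - 1)) := by positivity
    have : (q ^ (m+1+1) * q ^ 2 + 1) * (q ^ (m+1+1) - 1)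
          - (((m+1:ℕ):ℝ)+1) * q ^ (m+1+1) * (q ^ 2 - 1)
        = q * ((q ^ (m+1) * q ^ 2 + 1) * (q ^ (m+1) - 1)
            - ((m:ℝ)+1) * q ^ (m+1) * (q ^ 2 - 1))
          + (q - 1) * ((q ^ (m+3) - 1) * (q ^ (m+2) - 1)) := by
      push_cast; ring
    rw [this]
    linarith

lemma sd_form (p k : ℕ) (R L : ℝ) (hR : 0 < R) (hL : 0 < L) :
    sigmaDk (p+2) R L k = ((k:ℝ) + ((k:ℝ) + p) * ((R+L)/R) ^ (2*k+p)) /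
      (R * (((R+L)/R) ^ (2*k+p) - 1)) := by
  have e1 : (R + L) ^ (2 * (k : ℝ) + ((p+2:ℕ):ℝ) - 2) = (R+L) ^ (2*k+p) := by
    rw [← Real.rpow_natCast]; congr 1; push_cast; ring
  have e2 : R ^ (-2 * (k : ℝ) + 2 - ((p+2:ℕ):ℝ)) = (R ^ (2*k+p))⁻¹ := by
    rw [← Real.rpow_natCast, ← Real.rpow_neg hR.le]; congr 1; push_cast; ring
  have e3 : R ^ (-2 * (k : ℝ) + 3 - ((p+2:ℕ):ℝ)) = (R ^ (2*k+p))⁻¹ * R := by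
    rw [← e2, ← Real.rpow_add_one hR.ne']; congr 1; ring
  unfold sigmaDk
  rw [e1, e2, e3, div_pow]
  congr 1
  · push_cast; ring
  · ring

theorem steklov_dirichlet_strictMono_in_k
    (n : ℕ) (hn : 3 ≤ n) (k : ℕ) (hk : 1 ≤ k)
    (R L : ℝ) (hR : 0 < R) (hL : 0 < L) :
    sigmaDk n R L k < sigmaDk n R L (k + 1) := by
  obtain ⟨p, rfl⟩ : ∃ p, n = p + 2 := ⟨n - 2, by omega⟩
  rw [sd_form p k R L hR hL, sd_form p (k+1) R L hR hL]
  have hq : 1 < (R+L)/R := by rw [one_lt_div hR]; linarith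
  set q := (R+L)/R
  obtain ⟨m, hm⟩ : ∃ m, 2*k+p = m+1 := ⟨2*k+p-1, by omega⟩
  have key := sd_key q hq m
  have hm' : 2*(k:ℝ)+p = m+1 := by exact_mod_cast hm
  rw [← hm', ← hm] at key
  have e : q ^ (2*(k+1)+p) = q ^ (2*k+p) * q ^ 2 := by ring
  have hx : 0 < q ^ (2*k+p) - 1 := sub_pos.2 (one_lt_pow₀ hq (by omega))
  have hxy : 0 < q ^ (2*(k+1)+p) - 1 := sub_pos.2 (one_lt_pow₀ hq (by omega))
  rw [e] at hxy ⊢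
  generalize q ^ (2*k+p) = x at *
  generalize q ^ 2 = y at *
  rw [div_lt_div_iff₀ (by positivity) (by positivity)]
  have := mul_pos hR key
  push_cast
  linarith
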